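/- arXiv:2506.12021 — 9 statements merged into one kernel-verified Lean document; each statement's English description precedes it below -/
import Mathlib

section
/- Let G be a finite, simple, connected, undirected graph with at least 2 vertices, and let v be a leaf of G (a vertex of degree 1). Then v belongs to every monitoring edge-geodetic set of G. -/
/-- The pair `{x, y}` monitors the edge `e` if `e` belongs to every shortest
path (i.e. every walk of length `G.dist x y`) from `x` to `y` in `G`. -/
def monitors {V : Type*} (G : SimpleGraph V) (x y : V) (e : Sym2 V) : Prop :=
  ∀ p : G.Walk x y, p.length = G.dist x y → e ∈ p.edges

/-- A monitoring edge-geodetic set: every edge is monitored by some pair of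
vertices of `M`. -/
def isMEGSet {V : Type*} (G : SimpleGraph V) (M : Set V) : Prop :=
  ∀ e ∈ G.edgeSet, ∃ x ∈ M, ∃ y ∈ M, monitors G x y e

theorem leaf_mem_every_megSet {V : Type*} [Fintype V] (G : SimpleGraph V)
    [DecidableRel G.Adj] (hconn : G.Connected) (hcard : 2 ≤ Fintype.card V)
    (v : V) (hleaf : G.degree v = 1)
    (M : Set V) (hM : isMEGSet G M) : v ∈ M := by
  obtain ⟨w, hw, huniq⟩ := SimpleGraph.degree_eq_one_iff_existsUnique_adj.mp hleaf
  obtain ⟨x, hx, y, hy, hxy⟩ := hM s(v, w) hw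
  obtain ⟨p, hp, hlen⟩ := hconn.exists_path_of_dist x y
  have hv : (G.neighborSet v).Subsingleton := fun a ha b hb =>
    (huniq a ha).trans (huniq b hb).symm
  by_contra hvM
  exact hp.isTrail.not_mem_support_of_subsingleton_neighborSet
    (ne_of_mem_of_not_mem hx hvM).symm (ne_of_mem_of_not_mem hy hvM).symm hv
    (p.fst_mem_support_of_mem_edges (hxy p hlen))
end

section
/- Let G be a finite, simple, connected, undirected graph, let {u,v} ∈ E(G) be an edge such that v is a leaf and u is not a leaf, and let M be a monitoring edge-geodetic set of G. Then M \ {u} is also a monitoring edge-geodetic set of G. -/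
section

variable {V : Type*} {G : SimpleGraph V} {u v x y : V} {e : Sym2 V}

theorem monitors.symm (h : monitors G x y e) : monitors G y x e := fun p hp => by
  simpa using h p.reverse (by rw [SimpleGraph.Walk.length_reverse, hp, SimpleGraph.dist_comm])

theorem not_monitors_self : ¬ monitors G x x e := fun h => by
  simpa using h .nil (by simp)

theorem monitors.eq_of_adj (hxy : G.Adj x y) (h : monitors G x y e) : e = s(x, y) := by
  simpa using h hxy.toWalk (by simpa using (SimpleGraph.dist_eq_one_iff_adj.2 hxy).symm)

/-- A walk that leaves a leaf starts with the step to its only neighbor. -/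
theorem SimpleGraph.Walk.exists_eq_cons_of_leaf (huv : G.Adj u v)
    (hleaf : ∀ w, G.Adj v w → w = u) (hy : y ≠ v) (p : G.Walk v y) :
    ∃ q : G.Walk u y, p = .cons huv.symm q := by
  cases p with
  | nil => exact absurd rfl hy
  | cons h q =>
    obtain rfl := hleaf _ h
    exact ⟨q, rfl⟩

theorem SimpleGraph.dist_leaf (hconn : G.Connected) (huv : G.Adj u v)
    (hleaf : ∀ w, G.Adj v w → w = u) (hy : y ≠ v) : G.dist v y = G.dist u y + 1 := by
  apply le_antisymm
  · have h := hconn.dist_triangle (u := v) (v := u) (w := y)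
    rw [SimpleGraph.dist_eq_one_iff_adj.2 huv.symm] at h
    omega
  · obtain ⟨p, hp⟩ := hconn.exists_walk_length_eq_dist v y
    obtain ⟨q, rfl⟩ := p.exists_eq_cons_of_leaf huv hleaf hy
    have := SimpleGraph.dist_le q
    rw [SimpleGraph.Walk.length_cons] at hp
    omega

/-- A leaf monitors its pendant edge with every other vertex. -/
theorem monitors_leaf_edge (huv : G.Adj u v) (hleaf : ∀ w, G.Adj v w → w = u) (hy : y ≠ v) :
    monitors G v y s(u, v) := fun p _ => by
  obtain ⟨q, rfl⟩ := p.exists_eq_cons_of_leaf huv hleaf hy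
  simp [Sym2.eq_swap]

/-- In a monitoring pair, the neighbor of a leaf can be replaced by the leaf. -/
theorem monitors.leaf (hconn : G.Connected) (huv : G.Adj u v) (hleaf : ∀ w, G.Adj v w → w = u)
    (hy : y ≠ v) (h : monitors G u y e) : monitors G v y e := fun p hp => by
  obtain ⟨q, rfl⟩ := p.exists_eq_cons_of_leaf huv hleaf hy
  rw [SimpleGraph.dist_leaf hconn huv hleaf hy, SimpleGraph.Walk.length_cons] at hp
  exact List.mem_cons_of_mem _ (h q (by omega))

/-- An MEG-set contains every leaf. -/
theorem isMEGSet.leaf_mem (hconn : G.Connected) (huv : G.Adj u v)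
    (hleaf : ∀ w, G.Adj v w → w = u) {M : Set V} (hM : isMEGSet G M) : v ∈ M := by
  classical
  obtain ⟨x, hx, y, hy, h⟩ := hM s(u, v) huv
  by_contra hv
  have hxv : x ≠ v := fun hxv => hv (hxv ▸ hx)
  have hyv : y ≠ v := fun hyv => hv (hyv ▸ hy)
  obtain ⟨p, hp⟩ := hconn.exists_walk_length_eq_dist x y
  have hmem : v ∈ p.support := p.snd_mem_support_of_mem_edges (h p hp)
  have hlen := congrArg SimpleGraph.Walk.length (p.take_spec hmem)
  rw [SimpleGraph.Walk.length_append] at hlen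
  have hxd := SimpleGraph.dist_le (p.takeUntil v hmem)
  have hyd := SimpleGraph.dist_le (p.dropUntil v hmem)
  have htri := hconn.dist_triangle (u := x) (v := u) (w := y)
  rw [SimpleGraph.dist_comm, SimpleGraph.dist_leaf hconn huv hleaf hxv,
    SimpleGraph.dist_comm] at hxd
  rw [SimpleGraph.dist_leaf hconn huv hleaf hyv] at hyd
  omega

/-- A pair that monitors an edge other than `{u, v}` is not contained in `{u, v}`. -/
theorem monitors.eq_edge_of_mem (huv : G.Adj u v) (h : monitors G x y e)
    (hx : x = u ∨ x = v) (hy : y = u ∨ y = v) : e = s(u, v) := by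
  rcases hx with rfl | rfl <;> rcases hy with rfl | rfl
  · exact absurd h not_monitors_self
  · exact h.eq_of_adj huv
  · exact h.symm.eq_of_adj huv
  · exact absurd h not_monitors_self

end

theorem megSet_sdiff_of_leaf_neighbor {V : Type*} [Fintype V] (G : SimpleGraph V)
    [DecidableRel G.Adj] (hconn : G.Connected) (u v : V) (huv : G.Adj u v)
    (hv : G.degree v = 1) (hu : G.degree u ≠ 1)
    (M : Set V) (hM : isMEGSet G M) : isMEGSet G (M \ {u}) := by
  have hleaf : ∀ w, G.Adj v w → w = u := fun w hw =>
    (SimpleGraph.degree_eq_one_iff_existsUnique_adj.1 hv).unique hw huv.symm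
  have hvM : v ∈ M \ {u} := ⟨hM.leaf_mem hconn huv hleaf, huv.ne'⟩
  intro e he
  by_cases heuv : e = s(u, v)
  · subst heuv
    obtain ⟨w, huw, hwv⟩ : ∃ w, G.Adj u w ∧ w ≠ v := by
      by_contra! hw
      exact hu (SimpleGraph.degree_eq_one_iff_existsUnique_adj.2 ⟨v, huv, hw⟩)
    obtain ⟨x, hx, y, hy, h⟩ := hM s(u, w) huw
    obtain ⟨z, hz, hzu, hzv⟩ : ∃ z ∈ M, z ≠ u ∧ z ≠ v := by
      by_contra! hz
      have := h.eq_edge_of_mem huv (or_iff_not_imp_left.2 (hz x hx))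
        (or_iff_not_imp_left.2 (hz y hy))
      exact hwv (Sym2.congr_right.1 this)
    exact ⟨v, hvM, z, ⟨hz, hzu⟩, monitors_leaf_edge huv hleaf hzv⟩
  · obtain ⟨x, hx, y, hy, h⟩ := hM e he
    have hnot := fun hx hy => heuv (h.eq_edge_of_mem huv hx hy)
    by_cases hxu : x = u
    · subst hxu
      have hy' := not_or.1 (hnot (.inl rfl))
      exact ⟨v, hvM, y, ⟨hy, hy'.1⟩, h.leaf hconn huv hleaf hy'.2⟩
    · by_cases hyu : y = u
      · subst hyu
        have hxv : x ≠ v := fun hxv => hnot (.inr hxv) (.inl rfl)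
        exact ⟨x, ⟨hx, hxu⟩, v, hvM, (h.symm.leaf hconn huv hleaf hxv).symm⟩
      · exact ⟨x, ⟨hx, hxu⟩, y, ⟨hy, hyu⟩, h⟩
end

section
/- Let H be a finite, simple, connected, undirected graph with |V(H)| ≥ 2 and diameter at most 2, and let G be the augmented graph constructed from H. If VC is a vertex cover of H, then M = VC ∪ L'' ∪ {v_*'} is a monitoring edge-geodetic set of G. In particular, if |VC| = k, then |M| = k + |V(H)| + 1. -/
/-- Vertices of the augmented graph: the original vertices `orig v`, the
pendant path vertices `prime v` (= v') and `dprime v` (= v''), and the two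
extra vertices `star` (= v_*) and `starp` (= v_*'). -/
inductive AugV (V : Type*) : Type _
  | orig : V → AugV V
  | prime : V → AugV V
  | dprime : V → AugV V
  | star : AugV V
  | starp : AugV V

/-- Base relation generating the edges of the augmented graph. -/
def augRel {V : Type*} (H : SimpleGraph V) : AugV V → AugV V → Prop
  | .orig u, .orig v => H.Adj u v
  | .orig u, .prime v => u = v
  | .prime u, .dprime v => u = v
  | .star, .prime _ => True
  | .star, .starp => True
  | _, _ => False

/-- The augmented graph `G` built from `H`: each `v` gets a pendant path
`v — v' — v''`, and `v_*` is joined to `v_*'` and to every `v'`. -/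
def augGraph {V : Type*} (H : SimpleGraph V) : SimpleGraph (AugV V) :=
  SimpleGraph.fromRel (augRel H)

/-- A vertex cover: every edge has at least one endpoint in `C`. -/
def isVertexCover {V : Type*} (H : SimpleGraph V) (C : Set V) : Prop :=
  ∀ u v, H.Adj u v → u ∈ C ∨ v ∈ C

section AugGraph

variable {V : Type*} {H : SimpleGraph V}

theorem augGraph_adj_dprime {v : V} {x : AugV V} :
    (augGraph H).Adj (.dprime v) x ↔ x = .prime v := by
  cases x <;> simp [augGraph, augRel]

theorem augGraph_adj_prime {v : V} {x : AugV V} :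
    (augGraph H).Adj (.prime v) x ↔ x = .orig v ∨ x = .dprime v ∨ x = .star := by
  cases x <;> simp [augGraph, augRel, eq_comm]

theorem augGraph_adj_starp {x : AugV V} :
    (augGraph H).Adj .starp x ↔ x = .star := by
  cases x <;> simp [augGraph, augRel]

theorem augGraph_adj_orig_orig {u v : V} :
    (augGraph H).Adj (.orig u) (.orig v) ↔ H.Adj u v := by
  simpa [augGraph, augRel, H.adj_comm v u] using fun h : H.Adj u v => h.ne

theorem augGraph_adj_dprime_prime (v : V) : (augGraph H).Adj (.dprime v) (.prime v) :=
  augGraph_adj_dprime.2 rfl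

theorem augGraph_adj_prime_orig (v : V) : (augGraph H).Adj (.prime v) (.orig v) :=
  augGraph_adj_prime.2 (.inl rfl)

theorem augGraph_adj_prime_star (v : V) : (augGraph H).Adj (.prime v) .star :=
  augGraph_adj_prime.2 (.inr (.inr rfl))

theorem augGraph_adj_star_starp : (augGraph H).Adj .star .starp :=
  (augGraph_adj_starp.2 rfl).symm

/-- The only shortest path from `v''` to `v_*'` is `v'', v', v_*, v_*'`. -/
theorem edges_of_dprime_starp {v : V} (p : (augGraph H).Walk (.dprime v) .starp)
    (hp : p.length = (augGraph H).dist (.dprime v) .starp) :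
    p.edges = [s(.dprime v, .prime v), s(.prime v, .star), s(.star, .starp)] := by
  have hle : p.length ≤ 3 := hp ▸ SimpleGraph.dist_le
    (.cons (augGraph_adj_dprime_prime v) (.cons (augGraph_adj_prime_star v)
      (.cons augGraph_adj_star_starp .nil)))
  clear hp
  rcases p with _ | ⟨h₁, p⟩
  obtain rfl := augGraph_adj_dprime.1 h₁
  rcases p with _ | ⟨h₂, _ | ⟨h₃, _ | ⟨h₄, p⟩⟩⟩
  · simp [augGraph, augRel] at h₂
  · obtain rfl := augGraph_adj_starp.1 h₃.symm
    simp
  · simp only [SimpleGraph.Walk.length_cons] at hle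
    omega

/-- The only shortest path from `v''` to `v` is `v'', v', v`. -/
theorem edges_of_dprime_orig_self {v : V} (p : (augGraph H).Walk (.dprime v) (.orig v))
    (hp : p.length = (augGraph H).dist (.dprime v) (.orig v)) :
    p.edges = [s(.dprime v, .prime v), s(.prime v, .orig v)] := by
  have hle : p.length ≤ 2 := hp ▸ SimpleGraph.dist_le
    (.cons (augGraph_adj_dprime_prime v) (.cons (augGraph_adj_prime_orig v) .nil))
  clear hp
  rcases p with _ | ⟨h₁, p⟩
  obtain rfl := augGraph_adj_dprime.1 h₁
  rcases p with _ | ⟨h₂, _ | ⟨h₃, p⟩⟩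
  · simp
  · simp only [SimpleGraph.Walk.length_cons] at hle
    omega

/-- If `u` and `v` are adjacent in `H`, the only shortest path from `v''` to `u` is
`v'', v', v, u`. -/
theorem edges_of_dprime_orig_of_adj {u v : V} (huv : H.Adj u v)
    (p : (augGraph H).Walk (.dprime v) (.orig u))
    (hp : p.length = (augGraph H).dist (.dprime v) (.orig u)) :
    p.edges = [s(.dprime v, .prime v), s(.prime v, .orig v), s(.orig v, .orig u)] := by
  have hle : p.length ≤ 3 := hp ▸ SimpleGraph.dist_le
    (.cons (augGraph_adj_dprime_prime v) (.cons (augGraph_adj_prime_orig v)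
      (.cons (augGraph_adj_orig_orig.2 huv.symm) .nil)))
  clear hp
  rcases p with _ | ⟨h₁, p⟩
  obtain rfl := augGraph_adj_dprime.1 h₁
  rcases p with _ | ⟨h₂, _ | ⟨h₃, _ | ⟨h₄, p⟩⟩⟩
  · simp [augGraph, augRel, huv.ne] at h₂
  · obtain rfl | rfl | rfl := augGraph_adj_prime.1 h₂
    · simp
    · simp [augGraph, augRel] at h₃
    · simp [augGraph, augRel] at h₃
  · simp only [SimpleGraph.Walk.length_cons] at hle
    omega

/-- Every edge of the augmented graph, up to orientation, is of one of the five kinds. -/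
theorem augGraph_edge_cases {P : Sym2 (AugV V) → Prop}
    (orig : ∀ u v, H.Adj u v → P s(.orig v, .orig u))
    (prime_orig : ∀ v, P s(.prime v, .orig v))
    (dprime_prime : ∀ v, P s(.dprime v, .prime v))
    (prime_star : ∀ v, P s(.prime v, .star))
    (star_starp : P s(.star, .starp)) :
    ∀ e ∈ (augGraph H).edgeSet, P e := by
  have key : ∀ x y, augRel H x y → P s(x, y) := by
    rintro (u | u | u | _ | _) (v | v | v | _ | _) h <;> simp only [augRel] at h
    · exact orig v u h.symm
    · exact h ▸ Sym2.eq_swap ▸ prime_orig u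
    · exact h ▸ Sym2.eq_swap ▸ dprime_prime u
    · exact Sym2.eq_swap ▸ prime_star v
    · exact star_starp
  rintro ⟨x, y⟩ h
  obtain ⟨-, h | h⟩ := (SimpleGraph.fromRel_adj _ _ _).1 h
  · exact key x y h
  · change P s(x, y)
    exact Sym2.eq_swap ▸ key y x h

theorem isMEGSet_of_isVertexCover [Nontrivial V] (hconn : H.Connected) {C : Set V}
    (hC : isVertexCover H C) :
    isMEGSet (augGraph H) (AugV.orig '' C ∪ Set.range AugV.dprime ∪ {AugV.starp}) := by
  have mem_orig {v : V} (hv : v ∈ C) :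
      AugV.orig v ∈ AugV.orig '' C ∪ Set.range AugV.dprime ∪ {AugV.starp} := by simp [hv]
  have mem_dprime (v : V) :
      AugV.dprime v ∈ AugV.orig '' C ∪ Set.range AugV.dprime ∪ {AugV.starp} := by simp
  have mem_starp :
      AugV.starp ∈ AugV.orig '' C ∪ Set.range AugV.dprime ∪ {AugV.starp} := by simp
  refine augGraph_edge_cases (fun u v huv => ?_) (fun v => ?_) (fun v => ?_) (fun v => ?_) ?_
  · obtain hu | hv := hC u v huv
    · refine ⟨_, mem_dprime v, _, mem_orig hu, fun p hp => ?_⟩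
      simp [edges_of_dprime_orig_of_adj huv p hp]
    · refine ⟨_, mem_dprime u, _, mem_orig hv, fun p hp => ?_⟩
      simp [edges_of_dprime_orig_of_adj huv.symm p hp]
  · obtain ⟨u, hvu⟩ := hconn.preconnected.exists_adj_of_nontrivial v
    obtain hv | hu := hC v u hvu
    · refine ⟨_, mem_dprime v, _, mem_orig hv, fun p hp => ?_⟩
      simp [edges_of_dprime_orig_self p hp]
    · refine ⟨_, mem_dprime v, _, mem_orig hu, fun p hp => ?_⟩
      simp [edges_of_dprime_orig_of_adj hvu.symm p hp]
  · refine ⟨_, mem_dprime v, _, mem_starp, fun p hp => ?_⟩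
    simp [edges_of_dprime_starp p hp]
  · refine ⟨_, mem_dprime v, _, mem_starp, fun p hp => ?_⟩
    simp [edges_of_dprime_starp p hp]
  · obtain ⟨v⟩ := hconn.nonempty
    refine ⟨_, mem_dprime v, _, mem_starp, fun p hp => ?_⟩
    simp [edges_of_dprime_starp p hp]

theorem ncard_orig_union_dprime_union_starp [Fintype V] (C : Set V) :
    (AugV.orig '' C ∪ Set.range AugV.dprime ∪ {AugV.starp}).ncard =
      C.ncard + Fintype.card V + 1 := by
  have horig : Function.Injective (AugV.orig : V → AugV V) := fun _ _ h => by injection h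
  have hdprime : Function.Injective (AugV.dprime : V → AugV V) := fun _ _ h => by injection h
  rw [Set.union_singleton, Set.ncard_insert_of_notMem (by simp), Set.ncard_union_eq,
    Set.ncard_image_of_injective _ horig, ← Set.image_univ,
    Set.ncard_image_of_injective _ hdprime, Set.ncard_univ, Nat.card_eq_fintype_card]
  rw [Set.disjoint_left]
  rintro _ ⟨v, -, rfl⟩
  simp

end AugGraph

theorem vertexCover_to_megSet {V : Type*} [Fintype V] (H : SimpleGraph V)
    (hconn : H.Connected) (hcard : 2 ≤ Fintype.card V)
    (hdiam : ∀ x y : V, H.dist x y ≤ 2)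
    (VC : Set V) (hVC : isVertexCover H VC) (k : ℕ) :
    isMEGSet (augGraph H)
      ((AugV.orig '' VC) ∪ (Set.range AugV.dprime) ∪ {AugV.starp}) ∧
    (VC.ncard = k →
      ((AugV.orig '' VC) ∪ (Set.range AugV.dprime) ∪ {AugV.starp} :
          Set (AugV V)).ncard = k + Fintype.card V + 1) := by
  have : Nontrivial V := Fintype.one_lt_card_iff_nontrivial.1 hcard
  refine ⟨isMEGSet_of_isVertexCover hconn hVC, ?_⟩
  rintro rfl
  exact ncard_orig_union_dprime_union_starp VC
end

section
/- Let H be a finite, simple, connected, undirected graph with |V(H)| ≥ 2 and diameter at most 2, and let G be the augmented graph constructed from H. If M is a monitoring edge-geodetic set of G with |M| = k + |V(H)| + 1 for some natural number k, then M ∩ V(H) is a vertex cover of H of size at most k. -/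
/-- A vertex with a unique neighbour is not interior to any path. -/
theorem SimpleGraph.Walk.IsPath.notMem_support_of_unique_adj {V : Type*} {G : SimpleGraph V}
    {l w : V} (hl : ∀ z, G.Adj l z → z = w) {x y : V} {p : G.Walk x y} (hp : p.IsPath)
    (hx : x ≠ l) (hy : y ≠ l) : l ∉ p.support := by
  induction p with
  | nil => simpa using hx.symm
  | @cons x v y h p ih =>
    rw [SimpleGraph.Walk.cons_isPath_iff] at hp
    have hv : v ≠ l := by
      rintro rfl
      cases p with
      | nil => exact hy rfl
      | cons h' q =>
        obtain rfl := hl _ h'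
        obtain rfl := hl _ h.symm
        exact hp.2 (by simp)
    simpa [hx.symm] using ih hp.1 hv hy

/-- A pendant vertex of a connected graph lies in every MEG-set. -/
theorem isMEGSet.mem_of_unique_adj {V : Type*} {G : SimpleGraph V} (hG : G.Preconnected)
    {M : Set V} (hM : isMEGSet G M) {l w : V} (hlw : G.Adj l w)
    (hl : ∀ z, G.Adj l z → z = w) : l ∈ M := by
  obtain ⟨x, hx, y, hy, hxy⟩ := hM s(l, w) hlw
  obtain ⟨p, hp, hlen⟩ := (hG x y).exists_path_of_dist
  by_contra hlM
  exact hp.notMem_support_of_unique_adj hl (fun h => hlM (h ▸ hx)) (fun h => hlM (h ▸ hy))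
    (p.fst_mem_support_of_mem_edges (hxy p hlen))

/-- A path starting at `c` using the edge `s(c, d)` and not ending at
`d` begins with `c, d, b` for some `b` and does not use that edge again. -/
theorem SimpleGraph.Walk.IsPath.exists_tail_of_start_mem_edges {V : Type*} {G : SimpleGraph V}
    {c d y : V} {p : G.Walk c y} (hp : p.IsPath) (hd : y ≠ d) (he : s(c, d) ∈ p.edges) :
    ∃ (b : V) (q : G.Walk b y), G.Adj d b ∧ q.length + 2 = p.length ∧ s(c, d) ∉ q.edges := by
  cases p with
  | nil => simp at he
  | @cons _ v _ h p =>
    rw [SimpleGraph.Walk.cons_isPath_iff] at hp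
    have hnot : s(c, d) ∉ p.edges := fun h' => hp.2 (p.fst_mem_support_of_mem_edges h')
    obtain rfl : d = v := by
      rcases List.mem_cons.1 he with h' | h'
      · rcases Sym2.eq_iff.1 h' with h' | h'
        exacts [h'.2, absurd (h'.1 ▸ h) (G.irrefl)]
      · exact absurd h' hnot
    cases p with
    | nil => exact absurd rfl hd
    | @cons _ b _ h' q =>
      exact ⟨b, q, h', by simp, fun hq => hnot (by simp [hq])⟩

/-- A path using an edge `s(u, v)` whose ends differ from those of the path splits
around that edge. -/
theorem SimpleGraph.Walk.IsPath.exists_split_of_mem_edges {V : Type*} {G : SimpleGraph V}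
    {u v x y : V} {p : G.Walk x y} (hp : p.IsPath) (he : s(u, v) ∈ p.edges)
    (hxu : x ≠ u) (hxv : x ≠ v) (hyu : y ≠ u) (hyv : y ≠ v) :
    ∃ (a b c d : V) (p₁ : G.Walk x a) (p₂ : G.Walk b y), s(c, d) = s(u, v) ∧
      G.Adj a c ∧ G.Adj d b ∧ p₁.length + 3 + p₂.length = p.length ∧
      s(u, v) ∉ p₁.edges ∧ s(u, v) ∉ p₂.edges := by
  induction p with
  | nil => simp at he
  | @cons x z y h p ih =>
    rw [SimpleGraph.Walk.cons_isPath_iff] at hp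
    have hne : s(u, v) ≠ s(x, z) := by
      intro h'
      rcases Sym2.eq_iff.1 h' with h' | h'
      · exact hxu h'.1.symm
      · exact hxv h'.2.symm
    have he' : s(u, v) ∈ p.edges := by simpa [hne] using he
    by_cases hzu : z = u
    · subst hzu
      obtain ⟨b, q, hb, hlen, hq⟩ := hp.1.exists_tail_of_start_mem_edges hyv he'
      exact ⟨x, b, z, v, .nil, q, rfl, h, hb, by simp; lia, by simp, hq⟩
    by_cases hzv : z = v
    · subst hzv
      rw [Sym2.eq_swap] at he' ⊢
      obtain ⟨b, q, hb, hlen, hq⟩ := hp.1.exists_tail_of_start_mem_edges hyu he'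
      exact ⟨x, b, z, u, .nil, q, rfl, h, hb, by simp; lia, by simp, hq⟩
    obtain ⟨a, b, c, d, p₁, p₂, hcd, hac, hdb, hlen, h₁, h₂⟩ := ih hp.1 he' hzu hzv hyu hyv
    exact ⟨a, b, c, d, .cons h p₁, p₂, hcd, hac, hdb, by simp; lia, by simp [h₁, hne], h₂⟩

/-- If every three-edge walk through `s(u, v)` can be replaced by a walk which is shorter, or
equally long and avoids `s(u, v)`, then any pair monitoring `s(u, v)` contains `u` or `v`. -/
theorem monitors.mem_of_exists_detour {V : Type*} {G : SimpleGraph V} (hG : G.Preconnected)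
    {u v : V} (hdetour : ∀ a b c d, s(c, d) = s(u, v) → G.Adj a c → G.Adj d b →
      ∃ q : G.Walk a b, q.length < 3 ∨ q.length = 3 ∧ s(u, v) ∉ q.edges)
    {x y : V} (hxy : monitors G x y s(u, v)) : (x = u ∨ x = v) ∨ (y = u ∨ y = v) := by
  by_contra! hne
  obtain ⟨⟨hxu, hxv⟩, hyu, hyv⟩ := hne
  obtain ⟨p, hp, hlen⟩ := (hG x y).exists_path_of_dist
  obtain ⟨a, b, c, d, p₁, p₂, hcd, hac, hdb, hsum, h₁, h₂⟩ :=
    hp.exists_split_of_mem_edges (hxy p hlen) hxu hxv hyu hyv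
  obtain ⟨q, hq⟩ := hdetour a b c d hcd hac hdb
  have hle := G.dist_le (p₁.append (q.append p₂))
  simp only [SimpleGraph.Walk.length_append] at hle
  rcases hq with hq | ⟨hq, hnot⟩
  · lia
  · have hmem := hxy (p₁.append (q.append p₂))
      (by simp only [SimpleGraph.Walk.length_append]; lia)
    simp [h₁, h₂, hnot] at hmem

section AugmentedGraph

variable {V : Type*} {H : SimpleGraph V}

theorem augGraph_adj_orig_prime (v : V) : (augGraph H).Adj (.orig v) (.prime v) := by
  simp [augGraph, augRel]

theorem augGraph_adj_starp_star : (augGraph H).Adj .starp .star := by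
  simp [augGraph, augRel]

theorem eq_prime_of_augGraph_adj_dprime {v : V} {z : AugV V}
    (h : (augGraph H).Adj (.dprime v) z) : z = .prime v := by
  cases z <;> simp_all [augGraph, augRel]

theorem eq_star_of_augGraph_adj_starp {z : AugV V} (h : (augGraph H).Adj .starp z) :
    z = .star := by
  cases z <;> simp_all [augGraph, augRel]

theorem augGraph_adj_orig {v : V} {z : AugV V} (h : (augGraph H).Adj (.orig v) z) :
    z = .prime v ∨ ∃ w, z = .orig w := by
  cases z <;> simp_all [augGraph, augRel]

theorem augGraph_preconnected (H : SimpleGraph V) : (augGraph H).Preconnected := by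
  have hprime (v : V) : (augGraph H).Reachable (.prime v) .star :=
    (augGraph_adj_prime_star v).reachable
  have hstar (x : AugV V) : (augGraph H).Reachable x .star := by
    cases x with
    | orig v => exact (augGraph_adj_orig_prime v).reachable.trans (hprime v)
    | prime v => exact hprime v
    | dprime v => exact (augGraph_adj_dprime_prime v).reachable.trans (hprime v)
    | star => exact .refl _
    | starp => exact augGraph_adj_starp_star.reachable
  exact fun x y => (hstar x).trans (hstar y).symm

/-- The inclusion of `H` into its augmented graph. -/
def augGraphHom (H : SimpleGraph V) : H →g augGraph H where
  toFun := .orig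
  map_rel' h := augGraph_adj_orig_orig.2 h

theorem augGraph_exists_detour (hconn : H.Connected) (hdiam : ∀ x y : V, H.dist x y ≤ 2)
    {u v : V} {a b c d : AugV V} (hcd : s(c, d) = s(AugV.orig u, AugV.orig v))
    (hac : (augGraph H).Adj a c) (hdb : (augGraph H).Adj d b) :
    ∃ q : (augGraph H).Walk a b,
      q.length < 3 ∨ q.length = 3 ∧ s(AugV.orig u, AugV.orig v) ∉ q.edges := by
  obtain ⟨c, rfl⟩ : ∃ w, c = .orig w := by
    rcases Sym2.eq_iff.1 hcd with h | h
    exacts [⟨u, h.1⟩, ⟨v, h.1⟩]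
  obtain ⟨d, rfl⟩ : ∃ w, d = .orig w := by
    rcases Sym2.eq_iff.1 hcd with h | h
    exacts [⟨v, h.2⟩, ⟨u, h.2⟩]
  rcases augGraph_adj_orig hac.symm with rfl | ⟨w, rfl⟩ <;>
    rcases augGraph_adj_orig hdb with rfl | ⟨z, rfl⟩
  · exact ⟨.cons (augGraph_adj_prime_star c) (augGraph_adj_prime_star d).symm.toWalk,
      .inl (by simp)⟩
  · exact ⟨.cons (augGraph_adj_prime_star c) (.cons (augGraph_adj_prime_star z).symm
      (augGraph_adj_orig_prime z).symm.toWalk), .inr (by simp)⟩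
  · exact ⟨.cons (augGraph_adj_orig_prime w) (.cons (augGraph_adj_prime_star w)
      (augGraph_adj_prime_star d).symm.toWalk), .inr (by simp)⟩
  · obtain ⟨q, hq⟩ := hconn.exists_walk_length_eq_dist w z
    have hle := hdiam w z
    have hlen : (q.map (augGraphHom H)).length < 3 := by
      rw [SimpleGraph.Walk.length_map]
      lia
    exact ⟨q.map (augGraphHom H), .inl hlen⟩

theorem ncard_orig_add_card_add_one_le_ncard [Fintype V] {M : Set (AugV V)} (hfin : M.Finite)
    (hdprime : ∀ v, AugV.dprime v ∈ M) (hstarp : AugV.starp ∈ M) :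
    {v : V | AugV.orig v ∈ M}.ncard + Fintype.card V + 1 ≤ M.ncard := by
  have horig : (AugV.orig '' {v : V | AugV.orig v ∈ M}).ncard =
      {v : V | AugV.orig v ∈ M}.ncard :=
    Set.ncard_image_of_injective _ fun _ _ => AugV.orig.inj
  have hcard : (AugV.dprime '' (Set.univ : Set V)).ncard = Fintype.card V := by
    rw [Set.ncard_image_of_injective _ fun _ _ => AugV.dprime.inj, Set.ncard_univ,
      Nat.card_eq_fintype_card]
  rw [← horig, ← hcard, ← Set.ncard_union_eq (by
    rw [Set.disjoint_left]; rintro _ ⟨v, -, rfl⟩ ⟨w, -, h⟩; cases h)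
    (Set.toFinite _) (Set.toFinite _), ← Set.ncard_insert_of_notMem (a := AugV.starp) (by simp)
    (Set.toFinite _)]
  refine Set.ncard_le_ncard (Set.insert_subset hstarp (Set.union_subset ?_ ?_)) hfin
  · rintro _ ⟨v, hv, rfl⟩
    exact hv
  · rintro _ ⟨v, -, rfl⟩
    exact hdprime v

end AugmentedGraph

theorem megSet_to_vertexCover {V : Type*} [Fintype V] (H : SimpleGraph V)
    (hconn : H.Connected) (hcard : 2 ≤ Fintype.card V)
    (hdiam : ∀ x y : V, H.dist x y ≤ 2)
    (M : Set (AugV V)) (hM : isMEGSet (augGraph H) M) (k : ℕ)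
    (hsize : M.ncard = k + Fintype.card V + 1) :
    isVertexCover H {v : V | AugV.orig v ∈ M} ∧
    ({v : V | AugV.orig v ∈ M}).ncard ≤ k := by
  have hG := augGraph_preconnected H
  refine ⟨fun u v huv => ?_, ?_⟩
  · obtain ⟨x, hx, y, hy, hxy⟩ := hM s(.orig u, .orig v) (augGraph_adj_orig_orig.2 huv)
    rcases hxy.mem_of_exists_detour hG
      (fun _ _ _ _ => augGraph_exists_detour hconn hdiam) with (rfl | rfl) | (rfl | rfl)
    exacts [.inl hx, .inr hx, .inl hy, .inr hy]
  · have hle := ncard_orig_add_card_add_one_le_ncard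
      (Set.finite_of_ncard_pos (by lia : 0 < M.ncard))
      (fun v => hM.mem_of_unique_adj hG (augGraph_adj_dprime_prime v)
        fun _ => eq_prime_of_augGraph_adj_dprime)
      (hM.mem_of_unique_adj hG augGraph_adj_starp_star fun _ => eq_star_of_augGraph_adj_starp)
    lia
end

section
/- Let H be a finite, simple, connected, undirected graph with |V(H)| ≥ 2 and diameter at most 2, let G be the augmented graph constructed from H, and let k be a natural number. Then H has a vertex cover of size at most k if and only if G has a monitoring edge-geodetic set of size at most k + |V(H)| + 1. -/
namespace SimpleGraph

variable {V : Type*} {G : SimpleGraph V}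

/-- A walk through an edge splits into the parts before and after that edge. -/
theorem Walk.exists_length_split_of_mem_edges {a b x y : V} (p : G.Walk x y)
    (h : s(a, b) ∈ p.edges) :
    (∃ (q : G.Walk x a) (r : G.Walk b y), q.length + 1 + r.length = p.length) ∨
      ∃ (q : G.Walk x b) (r : G.Walk a y), q.length + 1 + r.length = p.length := by
  induction p with
  | nil => simp at h
  | cons hadj p ih =>
    rw [Walk.edges_cons, List.mem_cons] at h
    rcases h with h | h
    · rcases Sym2.eq_iff.1 h with ⟨rfl, rfl⟩ | ⟨rfl, rfl⟩
      · exact .inl ⟨.nil, p, by simp [add_comm]⟩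
      · exact .inr ⟨.nil, p, by simp [add_comm]⟩
    · rcases ih h with ⟨q, r, hqr⟩ | ⟨q, r, hqr⟩
      · exact .inl ⟨.cons hadj q, r, by simp only [Walk.length_cons]; omega⟩
      · exact .inr ⟨.cons hadj q, r, by simp only [Walk.length_cons]; omega⟩

/-- A function growing by at most one along each edge grows by at most the length of a walk. -/
theorem Walk.apply_le_apply_add_length {f : V → ℕ} (hf : ∀ a b, G.Adj a b → f a ≤ f b + 1)
    {x y : V} (p : G.Walk x y) : f x ≤ f y + p.length := by
  induction p with
  | nil => simp
  | cons hadj p ih =>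
    have := hf _ _ hadj
    rw [Walk.length_cons]
    omega

/-- A walk leaving a leaf can be shortened to start at the neighbour of the leaf. -/
theorem Walk.exists_shorter_of_leaf {l m y : V} (hl : ∀ z, G.Adj l z → z = m) (hy : y ≠ l)
    (p : G.Walk l y) : ∃ q : G.Walk m y, q.length + 1 = p.length := by
  cases p with
  | nil => exact absurd rfl hy
  | cons hadj q =>
    obtain rfl := hl _ hadj
    exact ⟨q, rfl⟩

end SimpleGraph

/-- The edge at a leaf is only monitored by pairs containing the leaf. -/
theorem monitors.eq_or_eq_of_leaf {V : Type*} {G : SimpleGraph V} (hG : G.Connected)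
    {l m x y : V} (hl : ∀ z, G.Adj l z → z = m) (h : monitors G x y s(l, m)) :
    x = l ∨ y = l := by
  by_contra! hne
  obtain ⟨p, hp⟩ := hG.exists_walk_length_eq_dist x y
  rcases p.exists_length_split_of_mem_edges (h p hp) with ⟨q, r, hqr⟩ | ⟨q, r, hqr⟩
  · obtain ⟨q', hq'⟩ := q.reverse.exists_shorter_of_leaf hl hne.1
    have := SimpleGraph.dist_le (q'.reverse.append r)
    simp only [SimpleGraph.Walk.length_append, SimpleGraph.Walk.length_reverse] at this hq'
    omega
  · obtain ⟨r', hr'⟩ := r.exists_shorter_of_leaf hl hne.2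
    have := SimpleGraph.dist_le (q.append r')
    simp only [SimpleGraph.Walk.length_append] at this
    omega

/-- A monitored edge lies on every walk that is no longer than a geodesic. -/
theorem monitors.mem_edges_of_length_le {V : Type*} {G : SimpleGraph V} {x y : V} {e : Sym2 V}
    (h : monitors G x y e) {p q : G.Walk x y} (hp : p.length = G.dist x y)
    (hq : q.length ≤ p.length) : e ∈ q.edges :=
  h q (le_antisymm (hq.trans hp.le) (SimpleGraph.dist_le q))

namespace AugV

variable {V : Type*} {H : SimpleGraph V}

instance [Finite V] : Finite (AugV V) :=
  Finite.of_surjective (α := (V ⊕ V ⊕ V) ⊕ Bool)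
    (Sum.elim (Sum.elim orig (Sum.elim prime dprime)) fun b => if b then star else starp) <| by
    rintro (v | v | v | _ | _)
    exacts [⟨.inl (.inl v), rfl⟩, ⟨.inl (.inr (.inl v)), rfl⟩, ⟨.inl (.inr (.inr v)), rfl⟩,
      ⟨.inr true, rfl⟩, ⟨.inr false, rfl⟩]

theorem adj_orig_iff {u : V} {x : AugV V} :
    (augGraph H).Adj (orig u) x ↔ x = prime u ∨ ∃ w, x = orig w ∧ H.Adj u w := by
  cases x <;> simp [augGraph, augRel, eq_comm, H.adj_comm]
  exact fun h => h.ne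

theorem adj_prime_iff {u : V} {x : AugV V} :
    (augGraph H).Adj (prime u) x ↔ x = orig u ∨ x = dprime u ∨ x = star := by
  cases x <;> simp [augGraph, augRel, eq_comm]

theorem adj_dprime_iff {u : V} {x : AugV V} :
    (augGraph H).Adj (dprime u) x ↔ x = prime u := by
  cases x <;> simp [augGraph, augRel]

theorem adj_star_iff {x : AugV V} :
    (augGraph H).Adj star x ↔ x = starp ∨ ∃ w, x = prime w := by
  cases x <;> simp [augGraph, augRel]

theorem adj_starp_iff {x : AugV V} : (augGraph H).Adj starp x ↔ x = star := by
  cases x <;> simp [augGraph, augRel]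

theorem adj_orig_orig {u v : V} : (augGraph H).Adj (orig u) (orig v) ↔ H.Adj u v := by
  simp [adj_orig_iff]

/-- The embedding of the original graph into the augmented graph. -/
def origHom (H : SimpleGraph V) : H →g augGraph H where
  toFun := orig
  map_rel' := adj_orig_orig.2

/-- The distance to the original vertices. -/
def height : AugV V → ℕ
  | orig _ => 0
  | prime _ => 1
  | dprime _ => 2
  | star => 2
  | starp => 3

/-- The distance to the vertex `star`. -/
def starDist : AugV V → ℕ
  | orig _ => 2
  | prime _ => 1
  | dprime _ => 2
  | star => 0
  | starp => 1

theorem height_le_of_adj {x y : AugV V} (h : (augGraph H).Adj x y) :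
    x.height ≤ y.height + 1 := by
  cases x <;>
    simp only [adj_orig_iff, adj_prime_iff, adj_dprime_iff, adj_star_iff, adj_starp_iff] at h <;>
    grind [height]

theorem height_le_length {x : AugV V} {u : V} (p : (augGraph H).Walk x (orig u)) :
    x.height ≤ p.length := by
  simpa [height] using p.apply_le_apply_add_length fun _ _ => height_le_of_adj

theorem starDist_le_length {x : AugV V} {u : V} (hx : x ≠ orig u)
    (p : (augGraph H).Walk x (orig u)) :
    x.starDist ≤ p.length + 1 ∧ ((∀ w, x ≠ orig w) → x.starDist ≤ p.length) ∧ 1 ≤ p.length := by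
  have hp : 1 ≤ p.length := by
    rw [Nat.one_le_iff_ne_zero]
    exact fun h => hx (p.eq_of_length_eq_zero h)
  have := height_le_length p
  cases x <;> simp_all [height, starDist]

theorem exists_walk_star (H : SimpleGraph V) (x : AugV V) :
    ∃ p : (augGraph H).Walk x star, p.length = x.starDist ∧
      ∀ u v, s(orig u, orig v) ∉ p.edges := by
  have hprime (w : V) : (augGraph H).Adj (prime w) star := by simp [adj_prime_iff]
  rcases x with w | w | w | _ | _
  · exact ⟨.cons (adj_orig_iff.2 (.inl rfl)) (.cons (hprime w) .nil), by simp [starDist]⟩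
  · exact ⟨.cons (hprime w) .nil, by simp [starDist]⟩
  · exact ⟨.cons (adj_dprime_iff.2 rfl) (.cons (hprime w) .nil), by simp [starDist]⟩
  · exact ⟨.nil, by simp [starDist]⟩
  · exact ⟨.cons (adj_starp_iff.2 rfl) .nil, by simp [starDist]⟩

theorem augGraph_connected (H : SimpleGraph V) : (augGraph H).Connected :=
  haveI : Nonempty (AugV V) := ⟨star⟩
  { preconnected := fun x y =>
      (exists_walk_star H x).choose.reachable.trans (exists_walk_star H y).choose.reachable.symm }

/-- When `H` has diameter at most two, an edge of `H` is only monitored by pairs that contain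
one of its endpoints. -/
theorem endpoint_of_monitors (hconn : H.Connected) (hdiam : ∀ x y : V, H.dist x y ≤ 2)
    {x y : AugV V} {u v : V} (h : monitors (augGraph H) x y s(orig u, orig v)) :
    (x = orig u ∨ x = orig v) ∨ (y = orig u ∨ y = orig v) := by
  by_contra! ⟨⟨hxu, hxv⟩, hyu, hyv⟩
  obtain ⟨p, hp⟩ := (augGraph_connected H).exists_walk_length_eq_dist x y
  have hlen : 3 ≤ p.length ∧
      (((∀ w, x ≠ orig w) ∨ ∀ w, y ≠ orig w) → x.starDist + y.starDist ≤ p.length) := by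
    rcases p.exists_length_split_of_mem_edges (h p hp) with ⟨q, r, hqr⟩ | ⟨q, r, hqr⟩
    · have hq := starDist_le_length hxu q
      have hr := starDist_le_length hyv r.reverse
      rw [SimpleGraph.Walk.length_reverse] at hr
      exact ⟨by omega, fun h => by rcases h with h | h <;> grind⟩
    · have hq := starDist_le_length hxv q
      have hr := starDist_le_length hyu r.reverse
      rw [SimpleGraph.Walk.length_reverse] at hr
      exact ⟨by omega, fun h => by rcases h with h | h <;> grind⟩
  by_cases hxy : (∀ w, x ≠ orig w) ∨ ∀ w, y ≠ orig w
  · obtain ⟨q, hq, hqe⟩ := exists_walk_star H x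
    obtain ⟨r, hr, hre⟩ := exists_walk_star H y
    have hmem := h.mem_edges_of_length_le (q := q.append r.reverse) hp (by
      simpa [hq, hr] using hlen.2 hxy)
    simp [hqe, hre] at hmem
  · push Not at hxy
    obtain ⟨⟨w, rfl⟩, z, rfl⟩ := hxy
    obtain ⟨q, hq⟩ := hconn.exists_walk_length_eq_dist w z
    have := SimpleGraph.dist_le (q.map (origHom H))
    rw [SimpleGraph.Walk.length_map] at this
    have := hdiam w z
    change _ = (augGraph H).dist (origHom H w) (origHom H z) at hp
    omega

/-- The set consisting of `C`, of all leaves `dprime v`, and of the leaf `starp`. -/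
def leafExtension (C : Set V) : Set (AugV V) :=
  insert starp (orig '' C ∪ Set.range dprime)

theorem ncard_leafExtension [Fintype V] (C : Set V) :
    (leafExtension C).ncard = C.ncard + Fintype.card V + 1 := by
  rw [leafExtension, Set.ncard_insert_of_notMem (by simp) (Set.toFinite _),
    Set.ncard_union_eq (by rw [Set.disjoint_left]; simp) (Set.toFinite _) (Set.toFinite _),
    Set.ncard_image_of_injective _ fun _ _ => orig.inj, ← Set.image_univ,
    Set.ncard_image_of_injective _ fun _ _ => dprime.inj, Set.ncard_univ,
    Nat.card_eq_fintype_card]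

theorem leafExtension_subset_of_isMEGSet {M : Set (AugV V)} (hM : isMEGSet (augGraph H) M) :
    leafExtension (orig ⁻¹' M) ⊆ M := by
  have leaf_mem {l m : AugV V} (hl : ∀ z, (augGraph H).Adj l z ↔ z = m) : l ∈ M := by
    obtain ⟨x, hx, y, hy, h⟩ := hM s(l, m) ((hl m).2 rfl)
    rcases h.eq_or_eq_of_leaf (augGraph_connected H) fun z => (hl z).1 with rfl | rfl
    exacts [hx, hy]
  rintro _ (rfl | ⟨v, hv, rfl⟩ | ⟨v, rfl⟩)
  exacts [leaf_mem fun _ => adj_starp_iff, hv, leaf_mem fun _ => adj_dprime_iff]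

theorem mem_edges_of_walk_dprime_starp {v : V} (p : (augGraph H).Walk (dprime v) starp)
    (hp : p.length ≤ 3) :
    s(prime v, dprime v) ∈ p.edges ∧ s(star, prime v) ∈ p.edges ∧ s(star, starp) ∈ p.edges := by
  rcases p with _ | ⟨h₁, p⟩
  obtain rfl := adj_dprime_iff.1 h₁
  rcases p with _ | ⟨h₂, p⟩
  rcases p with _ | ⟨h₃, p⟩
  · simp [adj_prime_iff] at h₂
  rcases p with _ | ⟨h₄, p⟩
  · obtain rfl := adj_starp_iff.1 h₃.symm
    simp [Sym2.eq_swap]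
  · simp only [SimpleGraph.Walk.length_cons] at hp
    omega

theorem mem_edges_of_walk_dprime_orig_self {v : V} (p : (augGraph H).Walk (dprime v) (orig v))
    (hp : p.length ≤ 2) : s(orig v, prime v) ∈ p.edges := by
  rcases p with _ | ⟨h₁, p⟩
  obtain rfl := adj_dprime_iff.1 h₁
  rcases p with _ | ⟨h₂, p⟩
  rcases p with _ | ⟨h₃, p⟩
  · simp [Sym2.eq_swap]
  · simp only [SimpleGraph.Walk.length_cons] at hp
    omega

theorem mem_edges_of_walk_dprime_orig {u v : V} (huv : u ≠ v)
    (p : (augGraph H).Walk (dprime v) (orig u)) (hp : p.length ≤ 3) :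
    s(orig v, prime v) ∈ p.edges ∧ s(orig u, orig v) ∈ p.edges := by
  rcases p with _ | ⟨h₁, p⟩
  obtain rfl := adj_dprime_iff.1 h₁
  rcases p with _ | ⟨h₂, p⟩
  rcases p with _ | ⟨h₃, p⟩
  · simp [adj_prime_iff, huv] at h₂
  rcases p with _ | ⟨h₄, p⟩
  · rcases adj_prime_iff.1 h₂ with rfl | rfl | rfl
    · simp [Sym2.eq_swap]
    · simp [adj_dprime_iff] at h₃
    · simp [adj_star_iff] at h₃
  · simp only [SimpleGraph.Walk.length_cons] at hp
    omega

theorem dist_dprime_starp_le (H : SimpleGraph V) (v : V) :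
    (augGraph H).dist (dprime v) starp ≤ 3 :=
  SimpleGraph.dist_le (.cons (adj_dprime_iff.2 rfl) (.cons (adj_prime_iff.2 (.inr (.inr rfl)))
    (.cons (adj_star_iff.2 (.inl rfl)) .nil)))

theorem dist_dprime_orig_self_le (H : SimpleGraph V) (v : V) :
    (augGraph H).dist (dprime v) (orig v) ≤ 2 :=
  SimpleGraph.dist_le (.cons (adj_dprime_iff.2 rfl) (.cons (adj_prime_iff.2 (.inl rfl)) .nil))

theorem dist_dprime_orig_le {u v : V} (h : H.Adj u v) :
    (augGraph H).dist (dprime v) (orig u) ≤ 3 :=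
  SimpleGraph.dist_le (.cons (adj_dprime_iff.2 rfl) (.cons (adj_prime_iff.2 (.inl rfl))
    (.cons (adj_orig_orig.2 h.symm) .nil)))

theorem isMEGSet_leafExtension [Nontrivial V] (hconn : H.Connected) {C : Set V}
    (hC : isVertexCover H C) : isMEGSet (augGraph H) (leafExtension C) := by
  have orig_mem {v : V} (hv : v ∈ C) : orig v ∈ leafExtension C := .inr (.inl ⟨v, hv, rfl⟩)
  have dprime_mem (v : V) : dprime v ∈ leafExtension C := .inr (.inr ⟨v, rfl⟩)
  have starp_mem : starp ∈ leafExtension C := .inl rfl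
  have spider (v : V) (p : (augGraph H).Walk (dprime v) starp)
      (hp : p.length = (augGraph H).dist (dprime v) starp) :=
    mem_edges_of_walk_dprime_starp p (hp.trans_le (dist_dprime_starp_le H v))
  have covered {u v : V} (h : H.Adj u v) (p : (augGraph H).Walk (dprime v) (orig u))
      (hp : p.length = (augGraph H).dist (dprime v) (orig u)) :=
    mem_edges_of_walk_dprime_orig h.ne p (hp.trans_le (dist_dprime_orig_le h))
  have main (x y : AugV V) (h : augRel H x y) :
      ∃ a ∈ leafExtension C, ∃ b ∈ leafExtension C, monitors (augGraph H) a b s(x, y) := by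
    rcases x with u | u | u | _ | _ <;> rcases y with v | v | v | _ | _ <;>
      simp only [augRel] at h
    · rcases hC u v h with hu | hv
      · exact ⟨_, dprime_mem v, _, orig_mem hu, fun p hp => (covered h p hp).2⟩
      · rw [Sym2.eq_swap]
        exact ⟨_, dprime_mem u, _, orig_mem hv, fun p hp => (covered h.symm p hp).2⟩
    · subst h
      obtain ⟨w, hw⟩ := hconn.preconnected.exists_adj_of_nontrivial u
      rcases hC u w hw with hu | hw'
      · exact ⟨_, dprime_mem u, _, orig_mem hu, fun p hp =>
          mem_edges_of_walk_dprime_orig_self p (hp.trans_le (dist_dprime_orig_self_le H u))⟩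
      · exact ⟨_, dprime_mem u, _, orig_mem hw', fun p hp => (covered hw.symm p hp).1⟩
    · subst h
      exact ⟨_, dprime_mem u, _, starp_mem, fun p hp => (spider u p hp).1⟩
    · exact ⟨_, dprime_mem v, _, starp_mem, fun p hp => (spider v p hp).2.1⟩
    · obtain ⟨v⟩ := hconn.nonempty
      exact ⟨_, dprime_mem v, _, starp_mem, fun p hp => (spider v p hp).2.2⟩
  intro e he
  induction e with | _ x y
  rcases ((SimpleGraph.fromRel_adj _ _ _).1 he).2 with h | h
  · exact main x y h
  · rw [Sym2.eq_swap]
    exact main y x h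

theorem isVertexCover_preimage_orig (hconn : H.Connected) (hdiam : ∀ x y : V, H.dist x y ≤ 2)
    {M : Set (AugV V)} (hM : isMEGSet (augGraph H) M) : isVertexCover H (orig ⁻¹' M) := by
  intro u v huv
  obtain ⟨x, hx, y, hy, h⟩ := hM s(orig u, orig v) (adj_orig_orig.2 huv)
  rcases endpoint_of_monitors hconn hdiam h with (rfl | rfl) | (rfl | rfl)
  exacts [.inl hx, .inr hx, .inl hy, .inr hy]

end AugV

theorem vertexCover_iff_megSet {V : Type*} [Fintype V] (H : SimpleGraph V)
    (hconn : H.Connected) (hcard : 2 ≤ Fintype.card V)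
    (hdiam : ∀ x y : V, H.dist x y ≤ 2) (k : ℕ) :
    (∃ VC : Set V, isVertexCover H VC ∧ VC.ncard ≤ k) ↔
    (∃ M : Set (AugV V), isMEGSet (augGraph H) M ∧
      M.ncard ≤ k + Fintype.card V + 1) := by
  constructor
  · rintro ⟨C, hC, hk⟩
    have : Nontrivial V := Fintype.one_lt_card_iff_nontrivial.1 hcard
    refine ⟨AugV.leafExtension C, AugV.isMEGSet_leafExtension hconn hC, ?_⟩
    rw [AugV.ncard_leafExtension]
    omega
  · rintro ⟨M, hM, hk⟩
    refine ⟨AugV.orig ⁻¹' M, AugV.isVertexCover_preimage_orig hconn hdiam hM, ?_⟩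
    have := Set.ncard_le_ncard (AugV.leafExtension_subset_of_isMEGSet hM) (Set.toFinite M)
    rw [AugV.ncard_leafExtension] at this
    omega
end

section
/- Let F be a finite, simple, connected, undirected graph with |V(F)| ≥ 3 and diameter at most 2, let c ≥ 1 be a natural number, and let G be the c-fold replicated augmented graph constructed from F. If F has a vertex cover of size at most k (k ∈ ℕ, k ≥ 1), then G has a monitoring edge-geodetic set of size at most c·k + |V(F)| + 1. -/
/-- Vertices of the `c`-fold replicated augmented graph: `copy i v` is the
vertex `v_i` of the `i`-th copy of `F`, `prime v` is `v'`, `dprime v` is `v''`,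
and `star`, `starp` are the two extra vertices `v_*`, `v_*'`. -/
inductive RepV (V : Type*) (c : ℕ) : Type _
  | copy : Fin c → V → RepV V c
  | prime : V → RepV V c
  | dprime : V → RepV V c
  | star : RepV V c
  | starp : RepV V c

/-- Base relation generating the edges of the replicated augmented graph. -/
def repRel {V : Type*} {c : ℕ} (F : SimpleGraph V) : RepV V c → RepV V c → Prop
  | .copy i u, .copy j v => i = j ∧ F.Adj u v
  | .copy _ u, .prime v => u = v
  | .prime u, .dprime v => u = v
  | .star, .prime _ => True
  | .star, .starp => True
  | _, _ => False

/-- The `c`-fold replicated augmented graph built from `F`: `c` disjoint copies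
of `F`, where each `v_i` is joined to `v'`, each `v'` to `v''` and to `v_*`,
and `v_*` to `v_*'`. -/
def repGraph {V : Type*} (F : SimpleGraph V) (c : ℕ) : SimpleGraph (RepV V c) :=
  SimpleGraph.fromRel (repRel F)

section RepGraphAdj

variable {V : Type*} {F : SimpleGraph V} {c : ℕ} {i j : Fin c} {u v : V} {w : RepV V c}

theorem repGraph_adj_copy_copy :
    (repGraph F c).Adj (.copy i u) (.copy j v) ↔ i = j ∧ F.Adj u v := by
  simp only [repGraph, SimpleGraph.fromRel_adj, repRel, ne_eq, RepV.copy.injEq]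
  constructor
  · rintro ⟨-, h | h⟩
    exacts [h, ⟨h.1.symm, h.2.symm⟩]
  · rintro ⟨rfl, h⟩
    exact ⟨fun e => h.ne e.2, .inl ⟨rfl, h⟩⟩

theorem repGraph_copy_adj :
    (repGraph F c).Adj (.copy i u) w ↔
      (∃ v, F.Adj u v ∧ w = .copy i v) ∨ w = .prime u := by
  cases w with
  | copy j v => rw [repGraph_adj_copy_copy]; aesop
  | _ => simp [repGraph, repRel, eq_comm]

theorem repGraph_prime_adj :
    (repGraph F c).Adj (.prime u) w ↔
      (∃ i, w = .copy i u) ∨ w = .dprime u ∨ w = .star := by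
  cases w <;> simp [repGraph, repRel, eq_comm]

theorem repGraph_dprime_adj : (repGraph F c).Adj (.dprime u) w ↔ w = .prime u := by
  cases w <;> simp [repGraph, repRel, eq_comm]

theorem repGraph_star_adj :
    (repGraph F c).Adj .star w ↔ (∃ v, w = .prime v) ∨ w = .starp := by
  cases w <;> simp [repGraph, repRel]

theorem repGraph_starp_adj : (repGraph F c).Adj .starp w ↔ w = .star := by
  cases w <;> simp [repGraph, repRel]

end RepGraphAdj

theorem monitors_of_walk {V : Type*} {G : SimpleGraph V} {x y : V} {e : Sym2 V}
    (q : G.Walk x y) (h : ∀ p : G.Walk x y, p.length ≤ q.length → e ∈ p.edges) :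
    monitors G x y e :=
  fun p hp => h p (hp.trans_le (SimpleGraph.dist_le q))

section Monitors

variable {V : Type*} {F : SimpleGraph V} {c : ℕ}

/-- The only shortest path from `v_*'` to `v''` is `v_*', v_*, v', v''`. -/
theorem monitors_starp_dprime (v : V) {e : Sym2 (RepV V c)}
    (he : e = s(.star, .starp) ∨ e = s(.star, .prime v) ∨ e = s(.prime v, .dprime v)) :
    monitors (repGraph F c) .starp (.dprime v) e := by
  refine monitors_of_walk
    (.cons (repGraph_starp_adj.2 rfl) (.cons (repGraph_star_adj.2 (.inl ⟨v, rfl⟩))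
      (.cons (repGraph_prime_adj.2 (.inr (.inl rfl))) .nil))) fun p hp => ?_
  rcases p with _ | ⟨h₁, _ | ⟨h₂, _ | ⟨h₃, _ | ⟨h₄, p⟩⟩⟩⟩
  · simp [repGraph_starp_adj] at h₁
  · obtain rfl := repGraph_starp_adj.1 h₁
    simp [repGraph_star_adj] at h₂
  · obtain rfl := repGraph_starp_adj.1 h₁
    obtain rfl := repGraph_dprime_adj.1 h₃.symm
    rcases he with rfl | rfl | rfl <;> simp
  · simp only [SimpleGraph.Walk.length_cons, SimpleGraph.Walk.length_nil] at hp
    omega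

/-- The only shortest path from `v_i` to `v''` is `v_i, v', v''`. -/
theorem monitors_copy_dprime (i : Fin c) (v : V) :
    monitors (repGraph F c) (.copy i v) (.dprime v) s(.copy i v, .prime v) := by
  refine monitors_of_walk
    (.cons (repGraph_copy_adj.2 (.inr rfl))
      (.cons (repGraph_prime_adj.2 (.inr (.inl rfl))) .nil)) fun p hp => ?_
  rcases p with _ | ⟨h₁, _ | ⟨h₂, _ | ⟨h₃, p⟩⟩⟩
  · simp [repGraph_copy_adj] at h₁
  · obtain rfl := repGraph_dprime_adj.1 h₂.symm
    simp
  · simp only [SimpleGraph.Walk.length_cons, SimpleGraph.Walk.length_nil] at hp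
    omega

/-- If `u` and `v` are adjacent, the only shortest path from `u_i` to `v''` is
`u_i, v_i, v', v''`. -/
theorem monitors_copy_dprime_of_adj (i : Fin c) {u v : V} (huv : F.Adj u v)
    {e : Sym2 (RepV V c)}
    (he : e = s(.copy i u, .copy i v) ∨ e = s(.copy i v, .prime v)) :
    monitors (repGraph F c) (.copy i u) (.dprime v) e := by
  refine monitors_of_walk
    (.cons (repGraph_copy_adj.2 (.inl ⟨v, huv, rfl⟩))
      (.cons (repGraph_copy_adj.2 (.inr rfl))
        (.cons (repGraph_prime_adj.2 (.inr (.inl rfl))) .nil))) fun p hp => ?_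
  rcases p with _ | ⟨h₁, _ | ⟨h₂, _ | ⟨h₃, _ | ⟨h₄, p⟩⟩⟩⟩
  · simp [repGraph_copy_adj] at h₁
  · obtain rfl := repGraph_dprime_adj.1 h₂.symm
    simp [repGraph_copy_adj, huv.ne'] at h₁
  · obtain rfl := repGraph_dprime_adj.1 h₃.symm
    obtain ⟨j, rfl⟩ | rfl | rfl := repGraph_prime_adj.1 h₂.symm
    · obtain ⟨rfl, -⟩ := repGraph_adj_copy_copy.1 h₁
      rcases he with rfl | rfl <;> simp
    all_goals simp [repGraph_copy_adj] at h₁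
  · simp only [SimpleGraph.Walk.length_cons, SimpleGraph.Walk.length_nil] at hp
    omega

end Monitors

/-- The copies of a set `C` of vertices of `F`, all `v''`, and `v_*'`. -/
def coverMEGSet {V : Type*} (c : ℕ) (C : Set V) : Set (RepV V c) :=
  (fun p : Fin c × V => RepV.copy p.1 p.2) '' (Set.univ ×ˢ C) ∪ Set.range RepV.dprime ∪ {.starp}

theorem ncard_coverMEGSet_le {V : Type*} [Fintype V] (c : ℕ) (C : Set V) :
    (coverMEGSet c C).ncard ≤ c * C.ncard + Fintype.card V + 1 := by
  have hcopy : ((fun p : Fin c × V => RepV.copy p.1 p.2) '' (Set.univ ×ˢ C)).ncard ≤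
      c * C.ncard := by
    refine (Set.ncard_image_le (Set.toFinite _)).trans ?_
    rw [Set.ncard_prod, Set.ncard_univ, Nat.card_fin]
  have hdprime : (Set.range (RepV.dprime : V → RepV V c)).ncard ≤ Fintype.card V := by
    rw [← Set.image_univ, ← Nat.card_eq_fintype_card, ← Set.ncard_univ]
    exact Set.ncard_image_le (Set.toFinite _)
  have hunion := Set.ncard_union_le
    ((fun p : Fin c × V => RepV.copy p.1 p.2) '' (Set.univ ×ˢ C)) (Set.range RepV.dprime)
  refine (Set.ncard_union_le _ _).trans ?_
  rw [Set.ncard_singleton]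
  omega

theorem isMEGSet_coverMEGSet {V : Type*} [Nontrivial V] {F : SimpleGraph V}
    (hconn : F.Connected) (c : ℕ) {C : Set V} (hC : isVertexCover F C) :
    isMEGSet (repGraph F c) (coverMEGSet c C) := by
  have hcopy : ∀ (i : Fin c) {v : V}, v ∈ C → RepV.copy i v ∈ coverMEGSet c C :=
    fun i v hv => .inl (.inl ⟨(i, v), ⟨trivial, hv⟩, rfl⟩)
  have hdprime : ∀ v : V, RepV.dprime v ∈ coverMEGSet c C := fun v => .inl (.inr ⟨v, rfl⟩)
  have hstarp : RepV.starp ∈ coverMEGSet c C := .inr rfl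
  have hrel : ∀ a b : RepV V c, repRel F a b →
      ∃ x ∈ coverMEGSet c C, ∃ y ∈ coverMEGSet c C, monitors (repGraph F c) x y s(a, b) := by
    intro a b hab
    rcases a with ⟨i, u⟩ | u | u | _ | _ <;> rcases b with ⟨j, v⟩ | v | v | _ | _ <;>
      simp only [repRel] at hab
    · obtain ⟨rfl, huv⟩ := hab
      rcases hC u v huv with hu | hv
      · exact ⟨_, hcopy i hu, _, hdprime v, monitors_copy_dprime_of_adj i huv (.inl rfl)⟩
      · exact ⟨_, hcopy i hv, _, hdprime u,
          monitors_copy_dprime_of_adj i huv.symm (.inl Sym2.eq_swap)⟩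
    · subst hab
      by_cases hu : u ∈ C
      · exact ⟨_, hcopy i hu, _, hdprime u, monitors_copy_dprime i u⟩
      · obtain ⟨w, hw⟩ := hconn.preconnected.exists_adj_of_nontrivial u
        exact ⟨_, hcopy i ((hC u w hw).resolve_left hu), _, hdprime u,
          monitors_copy_dprime_of_adj i hw.symm (.inr rfl)⟩
    · subst hab
      exact ⟨_, hstarp, _, hdprime u, monitors_starp_dprime u (.inr (.inr rfl))⟩
    · exact ⟨_, hstarp, _, hdprime v, monitors_starp_dprime v (.inr (.inl rfl))⟩
    · obtain ⟨v⟩ := hconn.nonempty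
      exact ⟨_, hstarp, _, hdprime v, monitors_starp_dprime v (.inl rfl)⟩
  intro e
  induction e with
  | h a b =>
    rintro ⟨-, h | h⟩
    · exact hrel a b h
    · rw [Sym2.eq_swap]
      exact hrel b a h

theorem vertexCover_to_megSet_replicated {V : Type*} [Fintype V]
    (F : SimpleGraph V) (hconn : F.Connected) (hcard : 3 ≤ Fintype.card V)
    (hdiam : ∀ x y : V, F.dist x y ≤ 2)
    (c : ℕ) (hc : 1 ≤ c) (k : ℕ) (hk : 1 ≤ k)
    (VC : Set V) (hVC : isVertexCover F VC) (hVCk : VC.ncard ≤ k) :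
    ∃ M : Set (RepV V c), isMEGSet (repGraph F c) M ∧
      M.ncard ≤ c * k + Fintype.card V + 1 := by
  have : Nontrivial V := Fintype.one_lt_card_iff_nontrivial.1 (by omega)
  refine ⟨coverMEGSet c VC, isMEGSet_coverMEGSet hconn c hVC,
    (ncard_coverMEGSet_le c VC).trans ?_⟩
  gcongr
end

section
/- Let F be a finite, simple, connected, undirected graph with |V(F)| ≥ 3 and diameter at most 2, let c ≥ 1 be a natural number, and let G be the c-fold replicated augmented graph constructed from F. If G has a monitoring edge-geodetic set of size at most c·k + |V(F)| + 1 for some natural number k ≥ 1, then F has a vertex cover of size at most k. -/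
/-- An edge of a walk splits it into the part before and the part after that edge. -/
lemma SimpleGraph.Walk.exists_split_of_mem_edges {V : Type*} {G : SimpleGraph V} {u v : V}
    {x y : V} (p : G.Walk x y) (h : s(u, v) ∈ p.edges) :
    (∃ (q : G.Walk x u) (r : G.Walk v y), q.length + 1 + r.length = p.length) ∨
      ∃ (q : G.Walk x v) (r : G.Walk u y), q.length + 1 + r.length = p.length := by
  induction p with
  | nil => simp at h
  | cons hadj p ih =>
    rw [edges_cons, List.mem_cons] at h
    rcases h with h | h
    · rcases Sym2.eq_iff.1 h with ⟨rfl, rfl⟩ | ⟨rfl, rfl⟩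
      · exact .inl ⟨nil, p, by simp; omega⟩
      · exact .inr ⟨nil, p, by simp; omega⟩
    · rcases ih h with ⟨q, r, hl⟩ | ⟨q, r, hl⟩
      · exact .inl ⟨cons hadj q, r, by simp; omega⟩
      · exact .inr ⟨cons hadj q, r, by simp; omega⟩

/-- A pendant edge is monitored only by pairs that contain its leaf. -/
lemma monitors.eq_leaf {V : Type*} {G : SimpleGraph V} {a l x y : V}
    (hl : ∀ w, G.Adj l w → w = a) (hr : G.Reachable x y) (h : monitors G x y s(a, l)) :
    x = l ∨ y = l := by
  obtain ⟨p, hp⟩ := hr.exists_walk_length_eq_dist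
  rcases p.exists_split_of_mem_edges (h p hp) with ⟨q, r, hlen⟩ | ⟨q, r, hlen⟩
  · cases r with
    | nil => exact .inr rfl
    | cons hadj r =>
      obtain rfl := hl _ hadj
      have := G.dist_le (q.append r)
      simp only [SimpleGraph.Walk.length_append, SimpleGraph.Walk.length_cons] at this hlen
      omega
  · rw [← q.length_reverse] at hlen
    generalize q.reverse = q' at hlen
    cases q' with
    | nil => exact .inl rfl
    | cons hadj q =>
      obtain rfl := hl _ hadj
      have := G.dist_le (q.reverse.append r)
      simp only [SimpleGraph.Walk.length_append, SimpleGraph.Walk.length_reverse,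
        SimpleGraph.Walk.length_cons] at this hlen
      omega

namespace RepV

variable {V : Type*} {c : ℕ}

instance [Finite V] : Finite (RepV V c) := by
  refine Finite.of_surjective
    (fun s : (Fin c × V) ⊕ V ⊕ V ⊕ Bool => match s with
      | .inl (i, v) => RepV.copy i v
      | .inr (.inl v) => .prime v
      | .inr (.inr (.inl v)) => .dprime v
      | .inr (.inr (.inr b)) => if b then .star else .starp) ?_
  rintro (⟨i, v⟩ | v | v | _ | _)
  · exact ⟨.inl (i, v), rfl⟩
  · exact ⟨.inr (.inl v), rfl⟩
  · exact ⟨.inr (.inr (.inl v)), rfl⟩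
  · exact ⟨.inr (.inr (.inr true)), rfl⟩
  · exact ⟨.inr (.inr (.inr false)), rfl⟩

/-- The distance from a vertex to `v_*`. -/
def height : RepV V c → ℕ
  | copy _ _ => 2
  | prime _ => 1
  | dprime _ => 2
  | star => 0
  | starp => 1

/-- The vertex lies in the `i`-th copy of `F`. -/
def InCopy (i : Fin c) (w : RepV V c) : Prop := ∃ v, w = copy i v

end RepV

section repGraph

open RepV

variable {V : Type*} {c : ℕ} (F : SimpleGraph V)

lemma repGraph_adj (x y : RepV V c) :
    (repGraph F c).Adj x y ↔ x ≠ y ∧ (repRel F x y ∨ repRel F y x) := Iff.rfl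

/-- Every vertex has a walk to `v_*` using no edge inside a copy of `F`. -/
lemma exists_walk_star (w : RepV V c) :
    ∃ p : (repGraph F c).Walk w star, p.length = w.height ∧
      ∀ i u v, s(copy i u, copy i v) ∉ p.edges := by
  have hps (v : V) : (repGraph F c).Adj (prime v) star := by simp [repGraph_adj, repRel]
  rcases w with ⟨i, v⟩ | v | v | _ | _
  · have h : (repGraph F c).Adj (copy i v) (prime v) := by simp [repGraph_adj, repRel]
    exact ⟨.cons h (.cons (hps v) .nil), rfl, by simp⟩
  · exact ⟨.cons (hps v) .nil, rfl, by simp⟩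
  · have h : (repGraph F c).Adj (dprime v) (prime v) := by simp [repGraph_adj, repRel]
    exact ⟨.cons h (.cons (hps v) .nil), rfl, by simp⟩
  · exact ⟨.nil, rfl, by simp⟩
  · have h : (repGraph F c).Adj starp star := by simp [repGraph_adj, repRel]
    exact ⟨.cons h .nil, rfl, by simp⟩

lemma repGraph_reachable (x y : RepV V c) : (repGraph F c).Reachable x y :=
  (exists_walk_star F x).choose.reachable.trans (exists_walk_star F y).choose.reachable.symm

/-- The `i`-th copy of `F` as a subgraph of the replicated graph. -/
def copyHom (i : Fin c) : F →g repGraph F c where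
  toFun := copy i
  map_rel' {u v} h := by simp [repGraph_adj, repRel, h, h.ne]

variable {F}

lemma height_le_length_succ {i : Fin c} {w : RepV V c} {u : V}
    (p : (repGraph F c).Walk w (copy i u)) (hw : w ≠ copy i u) : w.height ≤ p.length + 1 := by
  cases p with
  | nil => exact absurd rfl hw
  | cons h p => cases w <;> simp [height]

lemma height_le_length {i : Fin c} {w : RepV V c} {u : V}
    (p : (repGraph F c).Walk w (copy i u)) (hw : ¬ w.InCopy i) : w.height ≤ p.length := by
  cases p with
  | nil => exact absurd ⟨u, rfl⟩ hw
  | cons h p =>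
    cases p with
    | nil =>
      have hrel := (repGraph_adj F _ _).1 h
      cases w <;> simp_all [height, repRel, InCopy]
    | cons h' p => cases w <;> simp [height]

/-- An edge inside a copy of `F` is monitored only by pairs containing one of its endpoints. -/
lemma monitors.mem_copy_edge (hconn : F.Connected) (hdiam : ∀ x y : V, F.dist x y ≤ 2)
    {i : Fin c} {u v : V} {x y : RepV V c}
    (h : monitors (repGraph F c) x y s(copy i u, copy i v)) :
    (x = copy i u ∨ x = copy i v) ∨ (y = copy i u ∨ y = copy i v) := by
  by_contra! hne
  obtain ⟨⟨hxu, hxv⟩, hyu, hyv⟩ := hne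
  have key {a b : V} (hxa : x ≠ copy i a) (hyb : y ≠ copy i b)
      (q : (repGraph F c).Walk x (copy i a)) (r : (repGraph F c).Walk (copy i b) y)
      (hlen : q.length + 1 + r.length = (repGraph F c).dist x y) : False := by
    by_cases hin : x.InCopy i ∧ y.InCopy i
    · obtain ⟨⟨s, rfl⟩, t, rfl⟩ := hin
      obtain ⟨p, hp⟩ := (hconn s t).exists_walk_length_eq_dist
      have hle : (repGraph F c).dist (copy i s) (copy i t) ≤ p.length :=
        ((repGraph F c).dist_le (p.map (copyHom F i))).trans_eq (p.length_map _)
      have hq : q.length ≠ 0 := fun h0 => hxa (SimpleGraph.Walk.eq_of_length_eq_zero h0)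
      have hr : r.length ≠ 0 := fun h0 => hyb (SimpleGraph.Walk.eq_of_length_eq_zero h0).symm
      have := hdiam s t
      omega
    · obtain ⟨p₁, hl₁, hp₁⟩ := exists_walk_star F x
      obtain ⟨p₂, hl₂, hp₂⟩ := exists_walk_star F y
      have hx := height_le_length_succ q hxa
      have hy := height_le_length_succ r.reverse hyb
      have hsum : x.height + y.height ≤ q.length + 1 + r.length := by
        rw [r.length_reverse] at hy
        rcases not_and_or.1 hin with hin | hin
        · have := height_le_length q hin
          omega
        · have := height_le_length r.reverse hin
          rw [r.length_reverse] at this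
          omega
      have hd := (repGraph F c).dist_le (p₁.append p₂.reverse)
      have hmem := h (p₁.append p₂.reverse) (by
        simp only [SimpleGraph.Walk.length_append, SimpleGraph.Walk.length_reverse] at hd ⊢
        omega)
      simp [hp₁, hp₂] at hmem
  obtain ⟨p, hp⟩ := (repGraph_reachable F x y).exists_walk_length_eq_dist
  rcases p.exists_split_of_mem_edges (h p hp) with ⟨q, r, hlen⟩ | ⟨q, r, hlen⟩
  · exact key hxu hyv q r (hlen.trans hp)
  · exact key hxv hyu q r (hlen.trans hp)

lemma isMEGSet.dprime_mem {M : Set (RepV V c)} (hM : isMEGSet (repGraph F c) M) (v : V) :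
    dprime v ∈ M := by
  obtain ⟨x, hx, y, hy, h⟩ := hM s(prime v, dprime v) (by simp [repGraph_adj, repRel])
  have hl (w : RepV V c) (hw : (repGraph F c).Adj (dprime v) w) : w = prime v := by
    cases w <;> simp_all [repGraph_adj, repRel]
  rcases h.eq_leaf hl (repGraph_reachable F x y) with rfl | rfl <;> assumption

lemma isMEGSet.starp_mem {M : Set (RepV V c)} (hM : isMEGSet (repGraph F c) M) :
    starp ∈ M := by
  obtain ⟨x, hx, y, hy, h⟩ := hM s(star, starp) (by simp [repGraph_adj, repRel])
  have hl (w : RepV V c) (hw : (repGraph F c).Adj starp w) : w = star := by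
    cases w <;> simp_all [repGraph_adj, repRel]
  rcases h.eq_leaf hl (repGraph_reachable F x y) with rfl | rfl <;> assumption

lemma isMEGSet.isVertexCover_copy (hconn : F.Connected) (hdiam : ∀ x y : V, F.dist x y ≤ 2)
    {M : Set (RepV V c)} (hM : isMEGSet (repGraph F c) M) (i : Fin c) :
    isVertexCover F (copy i ⁻¹' M) := by
  intro u v huv
  obtain ⟨x, hx, y, hy, h⟩ := hM s(copy i u, copy i v) ((copyHom F i).map_adj huv)
  rcases h.mem_copy_edge hconn hdiam with (rfl | rfl) | (rfl | rfl)
  exacts [.inl hx, .inr hx, .inl hy, .inr hy]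

/-- The copies, the vertices `v''` and `v_*'` contribute disjointly to the size of a MEG-set. -/
lemma isMEGSet.sum_ncard_copy_le [Fintype V] {M : Set (RepV V c)}
    (hM : isMEGSet (repGraph F c) M) :
    ∑ i, (copy i ⁻¹' M).ncard + Fintype.card V + 1 ≤ M.ncard := by
  let f : ((Σ i : Fin c, ↥(copy i ⁻¹' M : Set V)) ⊕ V) ⊕ Unit → M := fun s => match s with
    | .inl (.inl ⟨i, v⟩) => ⟨copy i v, v.2⟩
    | .inl (.inr v) => ⟨dprime v, hM.dprime_mem v⟩
    | .inr () => ⟨starp, hM.starp_mem⟩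
  have hf : Function.Injective f := by
    rintro ((⟨i, v, hv⟩ | v) | _) ((⟨j, w, hw⟩ | w) | _) h <;> simp [f] at h ⊢
    · obtain ⟨rfl, rfl⟩ := h
      simp
    · exact h
  have := Nat.card_le_card_of_injective f hf
  simpa [Nat.card_sum, Nat.card_sigma, Nat.card_coe_set_eq] using this

end repGraph

theorem megSet_to_vertexCover_replicated {V : Type*} [Fintype V]
    (F : SimpleGraph V) (hconn : F.Connected) (hcard : 3 ≤ Fintype.card V)
    (hdiam : ∀ x y : V, F.dist x y ≤ 2)
    (c : ℕ) (hc : 1 ≤ c) (k : ℕ) (hk : 1 ≤ k)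
    (M : Set (RepV V c)) (hM : isMEGSet (repGraph F c) M)
    (hMk : M.ncard ≤ c * k + Fintype.card V + 1) :
    ∃ VC : Set V, isVertexCover F VC ∧ VC.ncard ≤ k := by
  by_contra! hVC
  have hcov (i : Fin c) : k + 1 ≤ (RepV.copy i ⁻¹' M).ncard :=
    hVC _ (hM.isVertexCover_copy hconn hdiam i)
  have hsum : c * (k + 1) ≤ ∑ i : Fin c, (RepV.copy i ⁻¹' M).ncard := by
    simpa using Finset.sum_le_sum fun i (_ : i ∈ Finset.univ) => hcov i
  have := hM.sum_ncard_copy_le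
  rw [Nat.mul_succ] at hsum
  omega
end

section
/- Let H be a finite, simple, connected, undirected graph with |V(H)| ≥ 2 and diameter at most 2, and let G be the augmented graph constructed from H. Then any two vertices of G are joined by a path of length at most 4 that uses only edges in E(G) \ E(H); in particular, the diameter of G is at most 4. -/
/-- Every vertex reaches `star` by a walk of length at most two that uses no edge of `H`. -/
theorem exists_walk_star_s11 {V : Type*} (H : SimpleGraph V) (x : AugV V) :
    ∃ p : (augGraph H).Walk x AugV.star, p.length ≤ 2 ∧
      ∀ e ∈ p.edges, ∀ u v : V, e ≠ s(AugV.orig u, AugV.orig v) := by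
  have hstar (v : V) : (augGraph H).Adj (.prime v) .star := by
    simp [augGraph, augRel]
  match x with
  | .orig v =>
    have h : (augGraph H).Adj (.orig v) (.prime v) := by simp [augGraph, augRel]
    exact ⟨.cons h (.cons (hstar v) .nil), by simp, by simp⟩
  | .prime v => exact ⟨.cons (hstar v) .nil, by simp, by simp⟩
  | .dprime v =>
    have h : (augGraph H).Adj (.dprime v) (.prime v) := by simp [augGraph, augRel]
    exact ⟨.cons h (.cons (hstar v) .nil), by simp, by simp⟩
  | .star => exact ⟨.nil, by simp, by simp⟩
  | .starp =>
    have h : (augGraph H).Adj .starp .star := by simp [augGraph, augRel]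
    exact ⟨.cons h .nil, by simp, by simp⟩

theorem aug_short_paths_avoiding_H {V : Type*} [Fintype V] (H : SimpleGraph V)
    (hconn : H.Connected) (hcard : 2 ≤ Fintype.card V)
    (hdiam : ∀ x y : V, H.dist x y ≤ 2) :
    (∀ x y : AugV V, ∃ p : (augGraph H).Walk x y, p.length ≤ 4 ∧
      ∀ e ∈ p.edges, ∀ u v : V, e ≠ s(AugV.orig u, AugV.orig v)) ∧
    ∀ x y : AugV V, (augGraph H).dist x y ≤ 4 := by
  have hwalk : ∀ x y : AugV V, ∃ p : (augGraph H).Walk x y, p.length ≤ 4 ∧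
      ∀ e ∈ p.edges, ∀ u v : V, e ≠ s(AugV.orig u, AugV.orig v) := by
    intro x y
    obtain ⟨p, hp, hpe⟩ := exists_walk_star_s11 H x
    obtain ⟨q, hq, hqe⟩ := exists_walk_star_s11 H y
    refine ⟨p.append q.reverse, ?_, fun e he => ?_⟩
    · rw [SimpleGraph.Walk.length_append, SimpleGraph.Walk.length_reverse]
      lia
    · rw [SimpleGraph.Walk.edges_append, SimpleGraph.Walk.edges_reverse, List.mem_append,
        List.mem_reverse] at he
      exact he.elim (hpe e) (hqe e)
  refine ⟨hwalk, fun x y => ?_⟩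
  obtain ⟨p, hp, -⟩ := hwalk x y
  exact (SimpleGraph.dist_le p).trans hp
end

section
/- Let H be a finite, simple, connected, undirected graph with |V(H)| ≥ 2 and diameter at most 2, and let G be the augmented graph constructed from H. For each u ∈ V(H), the unique shortest path in G from v_*' to u'' is ⟨{v_*',v_*}, {v_*,u'}, {u',u''}⟩, of length 3; consequently, both edges {v_*,u'} and {u',u''} are monitored by the pair {v_*', u''}. -/
namespace augGraph

variable {V : Type*} {H : SimpleGraph V}

theorem adj_starp_iff {x : AugV V} : (augGraph H).Adj .starp x ↔ x = .star := by
  cases x <;> simp [augGraph, augRel]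

theorem adj_dprime_iff {x : AugV V} {u : V} :
    (augGraph H).Adj x (.dprime u) ↔ x = .prime u := by
  cases x <;> simp [augGraph, augRel]

theorem adj_star_prime (u : V) : (augGraph H).Adj .star (.prime u) := by
  simp [augGraph, augRel]

/-- The path of length three from `starp` through `star` and `prime u` to `dprime u`. -/
def starpDprimeWalk (H : SimpleGraph V) (u : V) : (augGraph H).Walk .starp (.dprime u) :=
  .cons (adj_starp_iff.2 rfl) (.cons (adj_star_prime u) (.cons (adj_dprime_iff.2 rfl) .nil))

theorem three_le_length {u : V} (p : (augGraph H).Walk .starp (.dprime u)) : 3 ≤ p.length := by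
  cases p with
  | cons h q =>
    obtain rfl := adj_starp_iff.1 h
    cases q with
    | cons h' r =>
      cases r with
      | nil => cases adj_dprime_iff.1 h'
      | cons _ _ => simp only [SimpleGraph.Walk.length_cons]; lia

theorem dist_starp_dprime (u : V) : (augGraph H).dist .starp (.dprime u) = 3 := by
  refine le_antisymm (SimpleGraph.dist_le (starpDprimeWalk H u)) ?_
  obtain ⟨p, hp⟩ := (starpDprimeWalk H u).reachable.exists_walk_length_eq_dist
  exact hp ▸ three_le_length p

theorem eq_starpDprimeWalk {u : V} (p : (augGraph H).Walk .starp (.dprime u))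
    (hp : p.length = 3) : p = starpDprimeWalk H u := by
  cases p with
  | cons h q =>
    obtain rfl := adj_starp_iff.1 h
    cases q with
    | cons h' r =>
      cases r with
      | nil => cases adj_dprime_iff.1 h'
      | cons h'' s =>
        cases s with
        | nil =>
          obtain rfl := adj_dprime_iff.1 h''
          rfl
        | cons _ _ => simp at hp

end augGraph

theorem unique_shortest_path_starp_dprime {V : Type*} [Fintype V]
    (H : SimpleGraph V) (hconn : H.Connected) (hcard : 2 ≤ Fintype.card V)
    (hdiam : ∀ x y : V, H.dist x y ≤ 2) (u : V) :
    (augGraph H).dist AugV.starp (AugV.dprime u) = 3 ∧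
    (∀ p : (augGraph H).Walk AugV.starp (AugV.dprime u), p.length = 3 →
      p.edges = [s(AugV.starp, AugV.star), s(AugV.star, AugV.prime u),
        s(AugV.prime u, AugV.dprime u)]) ∧
    monitors (augGraph H) AugV.starp (AugV.dprime u) s(AugV.star, AugV.prime u) ∧
    monitors (augGraph H) AugV.starp (AugV.dprime u)
      s(AugV.prime u, AugV.dprime u) := by
  have edges_eq (p : (augGraph H).Walk AugV.starp (AugV.dprime u)) (hp : p.length = 3) :
      p.edges = [s(AugV.starp, AugV.star), s(AugV.star, AugV.prime u),
        s(AugV.prime u, AugV.dprime u)] := by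
    rw [augGraph.eq_starpDprimeWalk p hp]
    rfl
  have hdist := augGraph.dist_starp_dprime (H := H) u
  refine ⟨hdist, edges_eq, fun p hp => ?_, fun p hp => ?_⟩ <;>
    simp [edges_eq p (hp.trans hdist)]
end
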